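/- arXiv:2511.00835 — 2 statements merged into one kernel-verified Lean document; each statement's English description precedes it below -/
import Mathlib

section
/- Let χ and χ' be stable allocations with profiles h and h' respectively. Then |h_i − h'_i| ≤ 1 for every agent i; in other words, the Chebyshev distance between the profiles of any two stable allocations is at most 1. -/
open Finset

/-- `χ` is a (partial) allocation of `m` indivisible items to `n` agents respecting `likes`:
whenever item `o` is assigned to agent `j`, agent `j` likes item `o`. -/
def IsAlloc {m n : ℕ} (likes : Fin n → Fin m → Prop) (χ : Fin m → Option (Fin n)) : Prop :=
  ∀ o j, χ o = some j → likes j o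

/-- The profile of an allocation: agent `j` receives `prof χ j` items. -/
def prof {m n : ℕ} (χ : Fin m → Option (Fin n)) (j : Fin n) : ℕ :=
  (Finset.univ.filter fun o => χ o = some j).card

/-- Utilitarian social welfare: the total number of allocated items. -/
def usw {m n : ℕ} (χ : Fin m → Option (Fin n)) : ℕ := ∑ j, prof χ j

/-- A max-USW allocation. -/
def MaxUSW {m n : ℕ} (likes : Fin n → Fin m → Prop) (χ : Fin m → Option (Fin n)) : Prop :=
  IsAlloc likes χ ∧ ∀ χ', IsAlloc likes χ' → usw χ' ≤ usw χ

/-- A transfer path in `χ` from agent `u` to agent `v`: pairwise distinct agents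
`a 0 = u, …, a k = v` (`k ≥ 1`) and items `o 0, …, o (k-1)` with `χ` assigning `o t` to
`a t` and agent `a (t+1)` liking `o t`. -/
def TransferPath {m n : ℕ} (likes : Fin n → Fin m → Prop) (χ : Fin m → Option (Fin n))
    (u v : Fin n) : Prop :=
  ∃ k : ℕ, 1 ≤ k ∧ ∃ a : Fin (k + 1) → Fin n, Function.Injective a ∧
    a 0 = u ∧ a (Fin.last k) = v ∧
    ∃ o : Fin k → Fin m, ∀ t : Fin k,
      χ (o t) = some (a t.castSucc) ∧ likes (a t.succ) (o t)

/-- `χ` admits a narrowing transfer: a transfer path from `u` to `v` with `h_u ≥ h_v + 2`. -/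
def Narrowing {m n : ℕ} (likes : Fin n → Fin m → Prop) (χ : Fin m → Option (Fin n)) : Prop :=
  ∃ u v, TransferPath likes χ u v ∧ prof χ v + 2 ≤ prof χ u

/-- A stable allocation: max-USW and admitting no narrowing transfer. -/
def Stable {m n : ℕ} (likes : Fin n → Fin m → Prop) (χ : Fin m → Option (Fin n)) : Prop :=
  MaxUSW likes χ ∧ ¬ Narrowing likes χ

/-- The profile of `χ` sorted in ascending order. -/
noncomputable def sortedProf {m n : ℕ} (χ : Fin m → Option (Fin n)) : Fin n → ℕ :=
  prof χ ∘ Tuple.sort (prof χ)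

/-- A chain of `r`-related elements can be shortened to one without repetitions. -/
lemma Relation.ReflTransGen.exists_injOn_chain {α : Type*} {r : α → α → Prop} {u v : α}
    (h : Relation.ReflTransGen r u v) :
    ∃ (k : ℕ) (a : ℕ → α), Set.InjOn a (Set.Iic k) ∧ a 0 = u ∧ a k = v ∧
      ∀ t < k, r (a t) (a (t + 1)) := by
  classical
  induction h with
  | refl => exact ⟨0, fun _ => u, by intro x hx y hy _; simp_all, rfl, rfl, by simp⟩
  | @tail v w _ hvw ih =>
    obtain ⟨k, a, hinj, h0, hk, hr⟩ := ih
    by_cases hw : ∃ j ≤ k, a j = w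
    · obtain ⟨j, hj, hjw⟩ := hw
      exact ⟨j, a, hinj.mono (Set.Iic_subset_Iic.2 hj), h0, hjw, fun t ht => hr t (by omega)⟩
    · push Not at hw
      refine ⟨k + 1, Function.update a (k + 1) w, ?_, ?_, by simp, ?_⟩
      · intro x hx y hy hxy
        simp only [Set.mem_Iic] at hx hy
        simp only [Function.update_apply] at hxy
        split_ifs at hxy with h1 h2 h2
        · omega
        · exact absurd hxy.symm (hw y (by omega))
        · exact absurd hxy (hw x (by omega))
        · exact hinj (Set.mem_Iic.2 (by omega)) (Set.mem_Iic.2 (by omega)) hxy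
      · simpa [Function.update_apply] using h0
      · intro t ht
        rcases Nat.lt_succ_iff_lt_or_eq.1 ht with ht | rfl
        · rw [Function.update_of_ne (by omega), Function.update_of_ne (by omega)]
          exact hr t ht
        · rw [Function.update_of_ne (by omega), Function.update_self, hk]
          exact hvw

section

variable {m n : ℕ} {likes : Fin n → Fin m → Prop} {χ χ' : Fin m → Option (Fin n)}

/-- `TransferStep likes χ u v`: some item that `χ` assigns to `u` is liked by `v`. -/
def TransferStep {m n : ℕ} (likes : Fin n → Fin m → Prop) (χ : Fin m → Option (Fin n))
    (u v : Fin n) : Prop :=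
  ∃ o, χ o = some u ∧ likes v o

lemma transferPath_of_reflTransGen {u v : Fin n} (huv : u ≠ v)
    (h : Relation.ReflTransGen (TransferStep likes χ) u v) : TransferPath likes χ u v := by
  obtain ⟨k, a, hinj, h0, hk, hr⟩ := h.exists_injOn_chain
  have hk1 : 1 ≤ k := by
    rcases Nat.eq_zero_or_pos k with rfl | h
    · exact absurd (h0.symm.trans hk) huv
    · exact h
  choose o ho using fun t : Fin k => hr t t.isLt
  refine ⟨k, hk1, fun t => a t, ?_, h0, hk, o, ho⟩
  intro x y hxy
  exact Fin.ext (hinj (Set.mem_Iic.2 (by omega)) (Set.mem_Iic.2 (by omega)) hxy)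

lemma Stable.prof_le_of_reflTransGen (hχ : Stable likes χ) {u v : Fin n}
    (h : Relation.ReflTransGen (TransferStep likes χ) u v) : prof χ u ≤ prof χ v + 1 := by
  by_contra! hlt
  have huv : u ≠ v := by
    rintro rfl
    omega
  exact hχ.2 ⟨u, v, transferPath_of_reflTransGen huv h, hlt⟩

/-- A max-USW allocation assigns every item that somebody likes. -/
lemma MaxUSW.exists_eq_some (hχ : MaxUSW likes χ) {j : Fin n} {o : Fin m} (hj : likes j o) :
    ∃ i, χ o = some i := by
  by_contra! hnone
  have halloc : IsAlloc likes (Function.update χ o (some j)) := by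
    intro p i hp
    by_cases hpo : p = o
    · subst hpo
      simp only [Function.update_self, Option.some.injEq] at hp
      exact hp ▸ hj
    · rw [Function.update_of_ne hpo] at hp
      exact hχ.1 p i hp
  have hmono : ∀ i, (univ.filter fun p => χ p = some i) ⊆
      univ.filter fun p => Function.update χ o (some j) p = some i := by
    intro i p hp
    rw [mem_filter] at hp ⊢
    have hpo : p ≠ o := by
      rintro rfl
      exact hnone i hp.2
    rwa [Function.update_of_ne hpo]
  refine (hχ.2 _ halloc).not_gt (sum_lt_sum (fun i _ => card_le_card (hmono i))
    ⟨j, mem_univ j, card_lt_card ((ssubset_iff_of_subset (hmono j)).2 ⟨o, ?_, ?_⟩)⟩)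
  · simp
  · simpa using hnone j

lemma sum_prof_eq_card (χ : Fin m → Option (Fin n)) (T : Finset (Fin n)) :
    ∑ j ∈ T, prof χ j = (univ.filter fun o => ∃ j ∈ T, χ o = some j).card := by
  unfold prof
  rw [← card_biUnion]
  · congr 1
    ext o
    simp
  · intro i _ j _ hij
    refine disjoint_left.2 fun o hi hj => hij ?_
    simp only [mem_filter, mem_univ, true_and] at hi hj
    exact Option.some.inj (hi.symm.trans hj)

/-- Compare the two profiles on the agents that `i` reaches in `χ` and that reach `i` in `χ'`:
every item `χ` assigns to such agents is also assigned to such agents by `χ'`. -/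
lemma Stable.prof_le_prof_add_one (hχ : Stable likes χ) (hχ' : Stable likes χ') (i : Fin n) :
    prof χ i ≤ prof χ' i + 1 := by
  classical
  by_contra! hlt
  set T : Finset (Fin n) := univ.filter fun v =>
    Relation.ReflTransGen (TransferStep likes χ) i v ∧
      Relation.ReflTransGen (TransferStep likes χ') v i with hT
  have hle : ∑ j ∈ T, prof χ j ≤ ∑ j ∈ T, prof χ' j := by
    rw [sum_prof_eq_card, sum_prof_eq_card]
    refine card_le_card fun o ho => ?_
    simp only [hT, mem_filter, mem_univ, true_and] at ho ⊢
    obtain ⟨j, ⟨hij, hji⟩, hoj⟩ := ho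
    have hlikes := hχ.1.1 o j hoj
    obtain ⟨w, hw⟩ := hχ'.1.exists_eq_some hlikes
    exact ⟨w, ⟨hij.tail ⟨o, hoj, hχ'.1.1 o w hw⟩, hji.head ⟨o, hw, hlikes⟩⟩, hw⟩
  refine hle.not_gt (sum_lt_sum (fun v hv => ?_) ⟨i, ?_, by omega⟩)
  · simp only [hT, mem_filter, mem_univ, true_and] at hv
    have h1 := hχ.prof_le_of_reflTransGen hv.1
    have h2 := hχ'.prof_le_of_reflTransGen hv.2
    omega
  · simp only [hT, mem_filter, mem_univ, true_and]
    exact ⟨.refl, .refl⟩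

end

/-- the profiles of any two stable allocations are at Chebyshev distance at
most `1`: every agent's income differs by at most one between them. -/
theorem stable_profiles_chebyshev_le_one {m n : ℕ} (likes : Fin n → Fin m → Prop)
    (χ χ' : Fin m → Option (Fin n)) (hχ : Stable likes χ) (hχ' : Stable likes χ') :
    ∀ i : Fin n, |(prof χ i : ℤ) - (prof χ' i : ℤ)| ≤ 1 := by
  intro i
  have h1 := hχ.prof_le_prof_add_one hχ' i
  have h2 := hχ'.prof_le_prof_add_one hχ i
  rw [abs_le]
  omega
end

section
/- Let x and x' be stable divisible allocations, with (common) profile h. Then for every item o and all agents i, j: if x_{o,i} > 0 and x'_{o,j} > 0 then h_i = h_j. In particular (taking x' = x), in any stable divisible allocation each item is allocated entirely to agents having one and the same income, and the set of items allocated to the agents of a given income value d is the same for all stable divisible allocations. -/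
open Finset

/-- `x` is a divisible allocation of `m` divisible items to `n` agents respecting `likes`:
fractions are nonnegative, zero on disliked items, and each item is allocated to total
extent at most `1`. -/
def IsDAlloc {m n : ℕ} (likes : Fin n → Fin m → Prop) (x : Fin m → Fin n → ℝ) : Prop :=
  (∀ o j, 0 ≤ x o j) ∧ (∀ o j, ¬ likes j o → x o j = 0) ∧ (∀ o, ∑ j, x o j ≤ 1)

/-- The profile of a divisible allocation: agent `j` receives total amount `dprof x j`. -/
def dprof {m n : ℕ} (x : Fin m → Fin n → ℝ) (j : Fin n) : ℝ := ∑ o, x o j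

/-- A max-USW divisible allocation: the total allocated amount is maximal. -/
def DMaxUSW {m n : ℕ} (likes : Fin n → Fin m → Prop) (x : Fin m → Fin n → ℝ) : Prop :=
  IsDAlloc likes x ∧
    ∀ x', IsDAlloc likes x' → ∑ o, ∑ j, x' o j ≤ ∑ o, ∑ j, x o j

/-- A transfer path in a divisible allocation `x` from agent `u` to agent `v`: pairwise
distinct agents `a 0 = u, …, a k = v` (`k ≥ 1`) and items `o 0, …, o (k-1)` with
`x (o t) (a t) > 0` and agent `a (t+1)` liking `o t`. -/
def DTransferPath {m n : ℕ} (likes : Fin n → Fin m → Prop) (x : Fin m → Fin n → ℝ)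
    (u v : Fin n) : Prop :=
  ∃ k : ℕ, 1 ≤ k ∧ ∃ a : Fin (k + 1) → Fin n, Function.Injective a ∧
    a 0 = u ∧ a (Fin.last k) = v ∧
    ∃ o : Fin k → Fin m, ∀ t : Fin k,
      0 < x (o t) (a t.castSucc) ∧ likes (a t.succ) (o t)

/-- `x` admits a narrowing transfer: a transfer path from `u` to `v` with `h_u > h_v`. -/
def DNarrowing {m n : ℕ} (likes : Fin n → Fin m → Prop) (x : Fin m → Fin n → ℝ) : Prop :=
  ∃ u v, DTransferPath likes x u v ∧ dprof x v < dprof x u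

/-- A stable divisible allocation: max-USW and admitting no narrowing transfer. -/
def DStable {m n : ℕ} (likes : Fin n → Fin m → Prop) (x : Fin m → Fin n → ℝ) : Prop :=
  DMaxUSW likes x ∧ ¬ DNarrowing likes x

/-- The profile of `x` sorted in ascending order. -/
noncomputable def sortedDProf {m n : ℕ} (x : Fin m → Fin n → ℝ) : Fin n → ℝ :=
  dprof x ∘ Tuple.sort (dprof x)

section

variable {m n : ℕ} {likes : Fin n → Fin m → Prop} {x x' : Fin m → Fin n → ℝ}

theorem IsDAlloc.likes_of_pos (hx : IsDAlloc likes x) {o : Fin m} {j : Fin n}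
    (h : 0 < x o j) : likes j o := by
  by_contra hn
  exact h.ne' (hx.2.1 o j hn)

/-- An agent holding part of an item is no richer than any agent who likes it. -/
theorem DStable.dprof_le (hx : DStable likes x) {o : Fin m} {i j : Fin n}
    (hi : 0 < x o i) (hj : likes j o) : dprof x i ≤ dprof x j := by
  by_contra! hlt
  have hij : i ≠ j := by
    rintro rfl
    exact lt_irrefl _ hlt
  refine hx.2 ⟨i, j, ⟨1, le_rfl, ![i, j], ?_, rfl, rfl, fun _ => o, ?_⟩, hlt⟩
  · intro a b hab
    fin_cases a <;> fin_cases b <;> simp_all [eq_comm]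
  · intro t
    fin_cases t
    exact ⟨hi, hj⟩

theorem IsDAlloc.update (hx : IsDAlloc likes x) (hx' : IsDAlloc likes x') (o : Fin m) :
    IsDAlloc likes (Function.update x o (x' o)) := by
  refine ⟨fun p j => ?_, fun p j hj => ?_, fun p => ?_⟩ <;>
    rcases eq_or_ne p o with rfl | hp
  · simpa using hx'.1 p j
  · simpa [hp] using hx.1 p j
  · simpa using hx'.2.1 p j hj
  · simpa [hp] using hx.2.1 p j hj
  · simpa using hx'.2.2 p
  · simpa [hp] using hx.2.2 p

theorem DMaxUSW.row_sum_le (hx : DMaxUSW likes x) (hx' : IsDAlloc likes x') (o : Fin m) :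
    ∑ j, x' o j ≤ ∑ j, x o j := by
  have h := hx.2 _ (hx.1.update hx' o)
  rw [← Finset.add_sum_erase _ _ (Finset.mem_univ o),
    ← Finset.add_sum_erase _ (fun p => ∑ j, x p j) (Finset.mem_univ o)] at h
  have hrest : ∑ p ∈ univ.erase o, ∑ j, Function.update x o (x' o) p j
      = ∑ p ∈ univ.erase o, ∑ j, x p j :=
    Finset.sum_congr rfl fun p hp => by simp [Finset.ne_of_mem_erase hp]
  rw [hrest, Function.update_self] at h
  exact le_of_add_le_add_right h

theorem DStable.row_inner_dprof_le (hx : DStable likes x) (hx' : DMaxUSW likes x')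
    (o : Fin m) : ∑ i, x o i * dprof x i ≤ ∑ j, x' o j * dprof x j := by
  have hw : ∑ j, x' o j = ∑ j, x o j :=
    le_antisymm (hx.1.row_sum_le hx'.1 o) (hx'.row_sum_le hx.1.1 o)
  have hpair : ∀ i j, x o i * dprof x i * x' o j ≤ x o i * (x' o j * dprof x j) := by
    intro i j
    rcases (hx.1.1.1 o i).eq_or_lt with hi | hi
    · simp [← hi]
    rcases (hx'.1.1 o j).eq_or_lt with hj | hj
    · simp [← hj]
    have := mul_le_mul_of_nonneg_left (hx.dprof_le hi (hx'.1.likes_of_pos hj))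
      (mul_pos hi hj).le
    linarith
  have hprod : (∑ i, x o i * dprof x i) * ∑ j, x o j
      ≤ (∑ j, x' o j * dprof x j) * ∑ j, x o j := by
    rw [mul_comm (∑ j, x' o j * dprof x j), ← hw, Finset.sum_mul_sum, hw, Finset.sum_mul_sum]
    exact Finset.sum_le_sum fun i _ => Finset.sum_le_sum fun j _ => hpair i j
  rcases (Finset.sum_nonneg fun j _ => hx.1.1.1 o j).eq_or_lt with h0 | hpos
  · have hzero := (Finset.sum_eq_zero_iff_of_nonneg fun j _ => hx.1.1.1 o j).1 h0.symm
    have hzero' := (Finset.sum_eq_zero_iff_of_nonneg fun j _ => hx'.1.1 o j).1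
      (hw.trans h0.symm)
    rw [Finset.sum_eq_zero fun i hi => by rw [hzero i hi, zero_mul],
      Finset.sum_eq_zero fun j hj => by rw [hzero' j hj, zero_mul]]
  · exact le_of_mul_le_mul_right hprod hpos

theorem sum_dprof_mul (y : Fin m → Fin n → ℝ) (c : Fin n → ℝ) :
    ∑ i, dprof y i * c i = ∑ o, ∑ i, y o i * c i := by
  rw [Finset.sum_comm]
  simp [dprof, Finset.sum_mul]

theorem DStable.inner_dprof_le (hx : DStable likes x) (hx' : DMaxUSW likes x') :
    ∑ i, dprof x i * dprof x i ≤ ∑ i, dprof x' i * dprof x i := by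
  rw [sum_dprof_mul, sum_dprof_mul]
  exact Finset.sum_le_sum fun o _ => hx.row_inner_dprof_le hx' o

/-- All stable divisible allocations have the same profile. -/
theorem DStable.dprof_eq (hx : DStable likes x) (hx' : DStable likes x') :
    dprof x = dprof x' := by
  have h₁ := hx.inner_dprof_le hx'.1
  have h₂ := hx'.inner_dprof_le hx.1
  have hexpand : ∑ i, (dprof x i - dprof x' i) ^ 2
      = (∑ i, dprof x i * dprof x i - ∑ i, dprof x' i * dprof x i)
        + (∑ i, dprof x' i * dprof x' i - ∑ i, dprof x i * dprof x' i) := by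
    simp only [← Finset.sum_sub_distrib, ← Finset.sum_add_distrib]
    exact Finset.sum_congr rfl fun i _ => by ring
  have hzero : ∑ i, (dprof x i - dprof x' i) ^ 2 = 0 :=
    le_antisymm (by linarith) (Finset.sum_nonneg fun i _ => sq_nonneg _)
  funext i
  have hi := (Finset.sum_eq_zero_iff_of_nonneg fun i _ => sq_nonneg _).1 hzero i
    (Finset.mem_univ i)
  exact sub_eq_zero.1 (pow_eq_zero_iff two_ne_zero |>.1 hi)

end

/-- for stable divisible allocations `x, x'` (whose profiles coincide), if a
positive fraction of item `o` is given to agent `i` by `x` and to agent `j` by `x'`, then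
`i` and `j` have the same income.  In particular (taking `x' = x`), in any stable divisible
allocation each item goes entirely to agents of one common income, and the set of items
allocated to the agents of a given income is the same for all stable divisible
allocations. -/
theorem dstable_item_layers_invariant {m n : ℕ} (likes : Fin n → Fin m → Prop)
    (x x' : Fin m → Fin n → ℝ) (hx : DStable likes x) (hx' : DStable likes x') :
    ∀ (o : Fin m) (i j : Fin n), 0 < x o i → 0 < x' o j → dprof x i = dprof x' j := by
  intro o i j hi hj
  have heq := hx.dprof_eq hx'
  refine le_antisymm ?_ ?_
  · rw [← heq]
    exact hx.dprof_le hi (hx'.1.1.likes_of_pos hj)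
  · rw [heq]
    exact hx'.dprof_le hj (hx.1.1.likes_of_pos hi)
end
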